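/- Let (μ_t)_{t≥0} be a compactly supported measure-valued probability solution of the kinetic herding equation with centered means, and assume 0 < φ_m ≤ φ ≤ φ_M. Then V_φ(t) ≥ 2 φ_m V(t) for all t ≥ 0, and consequently ∫_0^t V(s) ds ≤ (1/(2φ_m)) ∫_0^t V_φ(s) ds = (E(0) − E(t))/(2 φ_m λ_v) ≤ E(0)/(2 φ_m λ_v) for all t ≥ 0, where E(t) = λ_w X(t) + V(t) + λ_x M(t). -/

import Mathlib

open MeasureTheory Filter Set RealInnerProductSpace

noncomputable section

abbrev Euc (d : ℕ) := EuclideanSpace ℝ (Fin d)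
abbrev Phase (d : ℕ) := Euc d × Euc d

/-- The nonlocal herding force `Q(x,v,μ)`. -/
noncomputable def herdQ {d : ℕ} (lw lx lv : ℝ) (φ : ℝ → ℝ) (μ : Measure (Phase d))
    (x v : Euc d) : Euc d :=
  ∫ z, (lw • (z.1 - x) + (lx * φ ‖x - z.1‖) • (z.1 - x)
      + (lv * φ ‖x - z.1‖) • (z.2 - v)) ∂μ

/-- Measure-valued solution of the kinetic herding equation on the time set `S`:
(i) finiteness, (ii) weak continuity in time against functions vanishing at infinity,
(iii) the weak formulation against compactly supported `C¹` test functions. -/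
def IsMVSol {d : ℕ} (lw lx lv : ℝ) (φ : ℝ → ℝ) (S : Set ℝ)
    (μ : ℝ → Measure (Phase d)) : Prop :=
  (∀ t ∈ S, IsFiniteMeasure (μ t)) ∧
  (∀ g : ZeroAtInftyContinuousMap (Phase d) ℝ,
      ContinuousOn (fun t => ∫ z, g z ∂(μ t)) S) ∧
  (∀ g : Phase d × ℝ → ℝ, ContDiff ℝ 1 g → HasCompactSupport g →
    ∀ t ∈ S,
      (∫ z, g (z, t) ∂(μ t)) - (∫ z, g (z, 0) ∂(μ 0)) =
      ∫ s in (0:ℝ)..t, (∫ z,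
        (deriv (fun u => g (z, u)) s
          + (fderiv ℝ (fun y => g ((y, z.2), s)) z.1) z.2
          + (fderiv ℝ (fun w => g ((z.1, w), s)) z.2)
              (herdQ lw lx lv φ (μ s) z.1 z.2)) ∂(μ s)))

/-- Topological support of a measure. -/
def msupport {d : ℕ} (μ : Measure (Phase d)) : Set (Phase d) :=
  {z | ∀ U : Set (Phase d), IsOpen U → z ∈ U → 0 < μ U}

/-- A measure has compact support. -/
def MeasureCompactSupport {d : ℕ} (μ : Measure (Phase d)) : Prop :=
  ∃ K : Set (Phase d), IsCompact K ∧ μ Kᶜ = 0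

/-- Wasserstein-1 distance in duality formulation: supremum of `|∫ g dμ - ∫ g dν|` over
functions `g` with `sup |g| ≤ 1` and Lipschitz constant `≤ 1`. -/
noncomputable def W1 {d : ℕ} (μ ν : Measure (Phase d)) : ℝ :=
  sSup {r : ℝ | ∃ g : Phase d → ℝ, (∀ z, |g z| ≤ 1) ∧ LipschitzWith 1 g ∧
    r = |(∫ z, g z ∂μ) - ∫ z, g z ∂ν|}

/-- Position variance functional `X(t)` (centered solutions). -/
noncomputable def Xfun {d : ℕ} (μ : ℝ → Measure (Phase d)) (t : ℝ) : ℝ :=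
  ∫ z, ‖z.1‖ ^ 2 ∂(μ t)

/-- Velocity variance functional `V(t)` (centered solutions). -/
noncomputable def Vfun {d : ℕ} (μ : ℝ → Measure (Phase d)) (t : ℝ) : ℝ :=
  ∫ z, ‖z.2‖ ^ 2 ∂(μ t)

/-- Covariance functional `C(X,V)(t)`. -/
noncomputable def Cfun {d : ℕ} (μ : ℝ → Measure (Phase d)) (t : ℝ) : ℝ :=
  ∫ z, ⟪z.1, z.2⟫ ∂(μ t)

/-- Weighted position energy `X_φ(t)`. -/
noncomputable def Xphi {d : ℕ} (φ : ℝ → ℝ) (μ : ℝ → Measure (Phase d)) (t : ℝ) : ℝ :=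
  ∫ z, (∫ w, φ ‖z.1 - w.1‖ * ‖z.1 - w.1‖ ^ 2 ∂(μ t)) ∂(μ t)

/-- Weighted velocity energy `V_φ(t)`. -/
noncomputable def Vphi {d : ℕ} (φ : ℝ → ℝ) (μ : ℝ → Measure (Phase d)) (t : ℝ) : ℝ :=
  ∫ z, (∫ w, φ ‖z.1 - w.1‖ * ‖z.2 - w.2‖ ^ 2 ∂(μ t)) ∂(μ t)

/-- Weighted covariance `C_φ(X,V)(t)`. -/
noncomputable def Cphi {d : ℕ} (φ : ℝ → ℝ) (μ : ℝ → Measure (Phase d)) (t : ℝ) : ℝ :=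
  ∫ z, (∫ w, φ ‖z.1 - w.1‖ * ⟪z.1 - w.1, z.2 - w.2⟫ ∂(μ t)) ∂(μ t)

/-- The potential `Φ(r) = (1/2) ∫_0^{r²} φ(√s) ds`. -/
noncomputable def Phifun (φ : ℝ → ℝ) (r : ℝ) : ℝ :=
  (1 / 2) * ∫ s in (0:ℝ)..(r ^ 2), φ (Real.sqrt s)

/-- Auxiliary (potential) functional `M(t)`. -/
noncomputable def Mfun {d : ℕ} (φ : ℝ → ℝ) (μ : ℝ → Measure (Phase d)) (t : ℝ) : ℝ :=
  ∫ z, (∫ w, Phifun φ ‖z.1 - w.1‖ ∂(μ t)) ∂(μ t)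


section Aux

variable {d : ℕ}

def qf (z : Phase d) : ℝ := ‖z.1‖ ^ 2 + ‖z.2‖ ^ 2

lemma qf_contDiff : ContDiff ℝ 1 (qf (d := d)) := by
  unfold qf
  exact (contDiff_fst.norm_sq ℝ).add (contDiff_snd.norm_sq ℝ)

lemma qf_cont : Continuous (qf (d := d)) := qf_contDiff.continuous

lemma qf_nonneg (z : Phase d) : 0 ≤ qf z := by unfold qf; positivity

lemma norm_lt_of_qf {z : Phase d} {N : ℝ} (h : qf z ≤ N) : ‖z‖ < N + 1 := by
  have h0 := qf_nonneg z
  unfold qf at h h0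
  have h1 := norm_nonneg z.1
  have h2 := norm_nonneg z.2
  rw [Prod.norm_def]
  apply max_lt <;> nlinarith

lemma isCompact_K (N : ℝ) : IsCompact {z : Phase d | qf z ≤ N} := by
  apply (isCompact_closedBall (0 : Phase d) (N+1)).of_isClosed_subset
  · exact isClosed_le qf_cont continuous_const
  · intro z hz
    simp only [mem_closedBall_zero_iff]
    exact (norm_lt_of_qf hz).le

def SB (ν : Measure (Phase d)) (N : ℝ) : Prop := ∀ᵐ z ∂ν, qf z ≤ N

lemma SB.compl {ν : Measure (Phase d)} {N : ℝ} (h : SB ν N) : ν {z : Phase d | qf z ≤ N}ᶜ = 0 := h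

lemma integrable_of_compact {X E : Type*} [TopologicalSpace X] [T2Space X] [MeasurableSpace X]
    [BorelSpace X] [SecondCountableTopology X]
    [NormedAddCommGroup E] {ν : Measure X} [IsFiniteMeasure ν] {K : Set X} (hK : IsCompact K)
    (h : ν Kᶜ = 0) {f : X → E} (hf : Continuous f) : Integrable f ν := by
  have h1 : IntegrableOn f K ν := hf.continuousOn.integrableOn_compact' hK hK.measurableSet
  rwa [IntegrableOn, Measure.restrict_eq_self_of_ae_mem] at h1
  exact h

lemma SB.integrable {E : Type*} [NormedAddCommGroup E] {ν : Measure (Phase d)} [IsFiniteMeasure ν]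
    {N : ℝ} (h : SB ν N) {f : Phase d → E} (hf : Continuous f) : Integrable f ν :=
  integrable_of_compact (isCompact_K N) h hf

lemma SB.prod_compl {ν ν' : Measure (Phase d)} [IsFiniteMeasure ν] [IsFiniteMeasure ν']
    {N N' : ℝ} (h : SB ν N) (h' : SB ν' N') :
    ∀ᵐ p ∂(ν.prod ν'), qf p.1 ≤ N ∧ qf p.2 ≤ N' := by
  have h1 : ∀ᵐ p ∂(ν.prod ν'), qf p.1 ≤ N := Measure.quasiMeasurePreserving_fst.ae h
  have h2 : ∀ᵐ p ∂(ν.prod ν'), qf p.2 ≤ N' := Measure.quasiMeasurePreserving_snd.ae h'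
  exact h1.and h2

lemma SB.integrable_prod {E : Type*} [NormedAddCommGroup E] {ν ν' : Measure (Phase d)}
    [IsFiniteMeasure ν] [IsFiniteMeasure ν']
    {N N' : ℝ} (h : SB ν N) (h' : SB ν' N') {f : Phase d × Phase d → E} (hf : Continuous f) :
    Integrable f (ν.prod ν') :=
  integrable_of_compact ((isCompact_K N).prod (isCompact_K N')) (h.prod_compl h') hf

lemma exists_cutoff (r : ℝ) : ∃ χ : Phase d → ℝ, ContDiff ℝ 1 χ ∧ HasCompactSupport χ ∧
    ∀ z, ‖z‖ < r → χ z = 1 := by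
  let b : ContDiffBump (0 : Phase d) := ⟨|r| + 1, |r| + 2, by positivity, by linarith⟩
  refine ⟨b, b.contDiff, b.hasCompactSupport, fun z hz => b.one_of_mem_closedBall ?_⟩
  rw [mem_closedBall_zero_iff]
  change ‖z‖ ≤ |r| + 1
  linarith [le_abs_self r]

lemma cont_single {μ : ℝ → Measure (Phase d)} {J : Set ℝ} {N : ℝ}
    (hvag : ∀ g : ZeroAtInftyContinuousMap (Phase d) ℝ,
      ContinuousOn (fun t => ∫ z, g z ∂(μ t)) (Set.Ici 0))
    (hJ : J ⊆ Set.Ici 0) (hS : ∀ s ∈ J, SB (μ s) N) {f : Phase d → ℝ} (hf : Continuous f) :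
    ContinuousOn (fun s => ∫ z, f z ∂(μ s)) J := by
  obtain ⟨χ, h1, h2, h3⟩ := exists_cutoff (d := d) (N + 1)
  let g : ZeroAtInftyContinuousMap (Phase d) ℝ :=
    ⟨⟨fun z => f z * χ z, hf.mul h1.continuous⟩, (h2.mul_left (f := f)).is_zero_at_infty⟩
  refine ((hvag g).mono hJ).congr fun s hs => ?_
  apply integral_congr_ae
  filter_upwards [hS s hs] with z hz
  change f z = f z * χ z
  rw [h3 z (norm_lt_of_qf hz), mul_one]

lemma cont_prod {μ : ℝ → Measure (Phase d)} {J : Set ℝ} {N : ℝ}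
    (hvag : ∀ g : ZeroAtInftyContinuousMap (Phase d) ℝ,
      ContinuousOn (fun t => ∫ z, g z ∂(μ t)) (Set.Ici 0))
    (hprob : ∀ t ∈ Set.Ici (0:ℝ), IsProbabilityMeasure (μ t))
    (hJ : J ⊆ Set.Ici 0) (hS : ∀ s ∈ J, SB (μ s) N) {H : Phase d × Phase d → ℝ}
    (hH : Continuous H) :
    ContinuousOn (fun p : ℝ × ℝ => ∫ z, ∫ w, H (z, w) ∂(μ p.2) ∂(μ p.1)) (J ×ˢ J) := by
  obtain ⟨χ, h1, h2, h3⟩ := exists_cutoff (d := d) (N + 1)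
  let P : J → ProbabilityMeasure (Phase d) := fun s => ⟨μ s, hprob s (hJ s.2)⟩
  have hP : Continuous P := by
    rw [ProbabilityMeasure.continuous_iff_forall_continuous_integral]
    intro f
    exact continuousOn_iff_continuous_restrict.1 (cont_single hvag hJ hS f.continuous)
  let G : Phase d × Phase d → ℝ := fun p => H p * (χ p.1 * χ p.2)
  have hGc : Continuous G := by
    have := h1.continuous
    fun_prop
  have hGs : HasCompactSupport G := by
    apply HasCompactSupport.mul_left
    refine HasCompactSupport.of_support_subset_isCompact (h2.isCompact.prod h2.isCompact) ?_
    intro p hp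
    rw [Function.mem_support] at hp
    exact ⟨subset_tsupport _ (left_ne_zero_of_mul hp), subset_tsupport _ (right_ne_zero_of_mul hp)⟩
  obtain ⟨C, hC⟩ := hGs.exists_bound_of_continuous hGc
  let Gb : BoundedContinuousFunction (Phase d × Phase d) ℝ :=
    BoundedContinuousFunction.ofNormedAddCommGroup G hGc C hC
  rw [continuousOn_iff_continuous_restrict]
  let e : ↥(J ×ˢ J) → J × J := fun p => (⟨p.1.1, p.2.1⟩, ⟨p.1.2, p.2.2⟩)
  have he : Continuous e := by
    refine Continuous.prodMk ?_ ?_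
    · exact (continuous_fst.comp continuous_subtype_val).subtype_mk _
    · exact (continuous_snd.comp continuous_subtype_val).subtype_mk _
  have hc : Continuous fun p : ↥(J ×ˢ J) => ∫ y, Gb y ∂((P (e p).1).prod (P (e p).2) :
      Measure (Phase d × Phase d)) := by
    have := ProbabilityMeasure.continuous_integral_boundedContinuousFunction Gb
    refine this.comp (ProbabilityMeasure.continuous_prod.comp
      (Continuous.prodMk (hP.comp (continuous_fst.comp he)) (hP.comp (continuous_snd.comp he))))
  convert hc using 2 with p
  obtain ⟨p, hp1, hp2⟩ := p
  have i1 := hprob _ (hJ hp1)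
  have i2 := hprob _ (hJ hp2)
  change ∫ z, ∫ w, H (z, w) ∂(μ p.2) ∂(μ p.1) = ∫ y, G y ∂((μ p.1).prod (μ p.2))
  rw [← integral_prod (f := H) ((hS _ hp1).integrable_prod (hS _ hp2) hH)]
  apply integral_congr_ae
  filter_upwards [(hS _ hp1).prod_compl (hS _ hp2)] with y hy
  simp only [G]
  rw [h3 _ (norm_lt_of_qf hy.1), h3 _ (norm_lt_of_qf hy.2), mul_one, mul_one]

lemma cont_diag {μ : ℝ → Measure (Phase d)} {J : Set ℝ} {N : ℝ}
    (hvag : ∀ g : ZeroAtInftyContinuousMap (Phase d) ℝ,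
      ContinuousOn (fun t => ∫ z, g z ∂(μ t)) (Set.Ici 0))
    (hprob : ∀ t ∈ Set.Ici (0:ℝ), IsProbabilityMeasure (μ t))
    (hJ : J ⊆ Set.Ici 0) (hS : ∀ s ∈ J, SB (μ s) N) {H : Phase d × Phase d → ℝ}
    (hH : Continuous H) :
    ContinuousOn (fun s : ℝ => ∫ z, ∫ w, H (z, w) ∂(μ s) ∂(μ s)) J := by
  have := cont_prod hvag hprob hJ hS hH
  exact this.comp (f := fun s : ℝ => (s, s)) (by fun_prop) (fun s hs => ⟨hs, hs⟩)

def kk (lw lx lv : ℝ) (φ : ℝ → ℝ) (z w : Phase d) : Euc d :=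
  lw • (w.1 - z.1) + (lx * φ ‖z.1 - w.1‖) • (w.1 - z.1) + (lv * φ ‖z.1 - w.1‖) • (w.2 - z.2)

lemma kk_cont {lw lx lv : ℝ} {φ : ℝ → ℝ} (hφ : Continuous φ) :
    Continuous fun p : Phase d × Phase d => kk lw lx lv φ p.1 p.2 := by
  unfold kk
  fun_prop

lemma H_cont {lw lx lv : ℝ} {φ : ℝ → ℝ} (hφ : Continuous φ) {f : Phase d → ℝ}
    (hf : ContDiff ℝ 1 f) :
    Continuous fun p : Phase d × Phase d => fderiv ℝ f p.1 (p.1.2, kk lw lx lv φ p.1 p.2) := by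
  have h1 : Continuous (fderiv ℝ f) := hf.continuous_fderiv one_ne_zero
  have h2 := kk_cont (d := d) (lw := lw) (lx := lx) (lv := lv) hφ
  exact (h1.comp continuous_fst).clm_apply
    ((continuous_snd.comp continuous_fst).prodMk h2)

lemma fderiv_herdQ {lw lx lv : ℝ} {φ : ℝ → ℝ} (hφ : Continuous φ) {ν : Measure (Phase d)}
    [IsProbabilityMeasure ν] {N : ℝ} (h : SB ν N) (L : Phase d →L[ℝ] ℝ) (z : Phase d) :
    L (z.2, 0) + L (0, herdQ lw lx lv φ ν z.1 z.2) = ∫ w, L (z.2, kk lw lx lv φ z w) ∂ν := by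
  have hc : Continuous fun w => kk lw lx lv φ z w := by
    unfold kk
    fun_prop
  have hi : Integrable (fun w => kk lw lx lv φ z w) ν := h.integrable hc
  obtain ⟨M, hM⟩ : ∃ M : Euc d →L[ℝ] ℝ, ∀ y, M y = L (0, y) :=
    ⟨L.comp (ContinuousLinearMap.inr ℝ (Euc d) (Euc d)), fun y => rfl⟩
  have hQ : herdQ lw lx lv φ ν z.1 z.2 = ∫ w, kk lw lx lv φ z w ∂ν := by
    unfold herdQ kk
    rfl
  have e2 : ∀ w, L (z.2, kk lw lx lv φ z w) = L (z.2, 0) + M (kk lw lx lv φ z w) := by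
    intro w
    rw [hM, ← map_add]
    simp
  have e3 : ∫ w, M (kk lw lx lv φ z w) ∂ν = M (∫ w, kk lw lx lv φ z w ∂ν) :=
    M.integral_comp_comm hi
  simp_rw [e2]
  rw [integral_add (integrable_const _) (M.integrable_comp hi), e3, hQ, hM]
  simp

lemma weak_deriv {lw lx lv : ℝ} {φ : ℝ → ℝ} (hφ : Continuous φ) {μ : ℝ → Measure (Phase d)}
    (hsol : IsMVSol lw lx lv φ (Set.Ici 0) μ)
    (hprob : ∀ t ∈ Set.Ici (0:ℝ), IsProbabilityMeasure (μ t))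
    {a b N : ℝ} (ha : 0 ≤ a) (hS : ∀ s ∈ Set.Icc a b, SB (μ s) N)
    {f : Phase d → ℝ} (hf : ContDiff ℝ 1 f) {t : ℝ} (ht : t ∈ Set.Ioo a b) :
    HasDerivAt (fun s => ∫ z, f z ∂(μ s))
      (∫ z, ∫ w, fderiv ℝ f z (z.2, kk lw lx lv φ z w) ∂(μ t) ∂(μ t)) t := by
  obtain ⟨-, hvag, hweak⟩ := hsol
  have hJ : Set.Icc a b ⊆ Set.Ici 0 := fun s hs => ha.trans hs.1
  set A : ℝ → ℝ := fun s => ∫ z, f z ∂(μ s) with hA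
  set B : ℝ → ℝ := fun s => ∫ z, ∫ w, fderiv ℝ f z (z.2, kk lw lx lv φ z w) ∂(μ s) ∂(μ s) with hB
  have hAc : ContinuousOn A (Set.Icc a b) := cont_single hvag hJ hS hf.continuous
  have hBc : ContinuousOn B (Set.Icc a b) := cont_diag hvag hprob hJ hS (H_cont hφ hf)
  obtain ⟨χ, h1, h2, h3⟩ := exists_cutoff (d := d) (N + 1)
  obtain ⟨δ, hδ, hδa, hδb⟩ : ∃ δ > 0, a ≤ t - 2 * δ ∧ t + 2 * δ ≤ b := by
    refine ⟨min (t - a) (b - t) / 2, ?_, ?_, ?_⟩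
    · have := lt_min (sub_pos.2 ht.1) (sub_pos.2 ht.2); linarith
    · have := min_le_left (t - a) (b - t); linarith
    · have := min_le_right (t - a) (b - t); linarith
  let η : ContDiffBump t := ⟨δ, 2 * δ, hδ, by linarith⟩
  have hη1 : ∀ s ∈ Metric.closedBall t δ, η s = 1 := fun s hs => η.one_of_mem_closedBall hs
  have hη0 : ∀ s, 2 * δ ≤ dist s t → η s = 0 := fun s hs => η.zero_of_le_dist hs
  have hηc : ContDiff ℝ 1 η := η.contDiff
  have hηout : ∀ s, s ∉ Set.Icc a b → η s = 0 ∧ deriv η s = 0 := by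
    intro s hs
    have hs' : 2 * δ < dist s t := by
      rw [Real.dist_eq]
      by_contra hcon
      rw [not_lt, abs_le] at hcon
      exact hs ⟨by linarith [hcon.1], by linarith [hcon.2]⟩
    refine ⟨hη0 s hs'.le, ?_⟩
    have : η =ᶠ[nhds s] fun _ => (0:ℝ) := by
      have ho : IsOpen {u : ℝ | 2 * δ < dist u t} :=
        isOpen_lt continuous_const (continuous_id.dist continuous_const)
      filter_upwards [ho.mem_nhds hs'] with u hu using hη0 u (le_of_lt hu)
    rw [this.deriv_eq]
    simp
  let F : Phase d → ℝ := fun z => χ z * f z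
  have hF : ContDiff ℝ 1 F := h1.mul hf
  let g : Phase d × ℝ → ℝ := fun p => η p.2 * F p.1
  have hg : ContDiff ℝ 1 g := (hηc.comp contDiff_snd).mul (hF.comp contDiff_fst)
  have hgs : HasCompactSupport g := by
    refine HasCompactSupport.of_support_subset_isCompact
      (h2.isCompact.prod η.hasCompactSupport.isCompact) ?_
    intro p hp
    rw [Function.mem_support] at hp
    exact ⟨subset_tsupport _ (left_ne_zero_of_mul (right_ne_zero_of_mul hp)),
      subset_tsupport _ (left_ne_zero_of_mul hp)⟩
  let G : ℝ → ℝ := fun s => deriv η s * A s + η s * B s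
  have hder : ∀ z s, deriv (fun u => g (z, u)) s = deriv η s * F z := by
    intro z s
    have := ((hηc.differentiable one_ne_zero s).hasDerivAt.mul_const (F z))
    exact this.deriv
  have hGeq : ∀ s, (∫ z,
        (deriv (fun u => g (z, u)) s
          + (fderiv ℝ (fun y => g ((y, z.2), s)) z.1) z.2
          + (fderiv ℝ (fun w => g ((z.1, w), s)) z.2)
              (herdQ lw lx lv φ (μ s) z.1 z.2)) ∂(μ s)) = G s := by
    intro s
    by_cases hs : s ∈ Set.Icc a b
    · have ip := hprob s (hJ hs)
      have hSs := hS s hs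
      have key : ∀ᵐ z ∂(μ s), (deriv (fun u => g (z, u)) s
          + (fderiv ℝ (fun y => g ((y, z.2), s)) z.1) z.2
          + (fderiv ℝ (fun w => g ((z.1, w), s)) z.2)
              (herdQ lw lx lv φ (μ s) z.1 z.2)) = deriv η s * f z
            + η s * ∫ w, fderiv ℝ f z (z.2, kk lw lx lv φ z w) ∂(μ s) := by
        filter_upwards [hSs] with z hz
        have hzn := norm_lt_of_qf hz
        have hFf : F =ᶠ[nhds z] f := by
          have ho : IsOpen {u : Phase d | ‖u‖ < N + 1} := isOpen_lt continuous_norm continuous_const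
          filter_upwards [ho.mem_nhds hzn] with u hu
          simp only [F]
          rw [h3 u hu, one_mul]
        have hFd : HasFDerivAt F (fderiv ℝ f z) z :=
          ((hf.differentiable one_ne_zero z).hasFDerivAt).congr_of_eventuallyEq hFf
        have hFx : HasFDerivAt (fun y => g ((y, z.2), s))
            (η s • (fderiv ℝ f z).comp (ContinuousLinearMap.inl ℝ (Euc d) (Euc d))) z.1 := by
          have := HasFDerivAt.comp (f := fun y : Euc d => (y, z.2)) (g := F) z.1 hFd
            (hasFDerivAt_prodMk_left z.1 z.2)
          exact this.const_mul (η s)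
        have hFv : HasFDerivAt (fun w => g ((z.1, w), s))
            (η s • (fderiv ℝ f z).comp (ContinuousLinearMap.inr ℝ (Euc d) (Euc d))) z.2 := by
          have := HasFDerivAt.comp (f := fun y : Euc d => (z.1, y)) (g := F) z.2 hFd
            (hasFDerivAt_prodMk_right z.1 z.2)
          exact this.const_mul (η s)
        rw [hder, hFx.fderiv, hFv.fderiv, hFf.eq_of_nhds, ← fderiv_herdQ hφ hSs]
        simp only [_root_.smul_apply, ContinuousLinearMap.comp_apply,
          ContinuousLinearMap.inl_apply, ContinuousLinearMap.inr_apply, smul_eq_mul]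
        ring
      rw [integral_congr_ae key, integral_add, integral_const_mul, integral_const_mul]
      · exact (hSs.integrable hf.continuous).const_mul _
      · exact ((hSs.integrable_prod hSs (H_cont hφ hf)).integral_prod_left).const_mul _
    · obtain ⟨e0, e1⟩ := hηout s hs
      have : ∀ z : Phase d × ℝ, z.2 = s → g z = 0 := by
        rintro ⟨z, u⟩ rfl
        simp [g, e0]
      have hx : ∀ z : Phase d, (fun y => g ((y, z.2), s)) = fun _ => (0:ℝ) := by
        intro z; funext y; exact this _ rfl
      have hv : ∀ z : Phase d, (fun w => g ((z.1, w), s)) = fun _ => (0:ℝ) := by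
        intro z; funext y; exact this _ rfl
      simp only [hder, hx, hv, e1, G, e0]
      simp
  have hGc : ContinuousOn G (Set.Icc a b) :=
    ((hηc.continuous_deriv le_rfl).continuousOn.mul hAc).add (hηc.continuous.continuousOn.mul hBc)
  have hGi : Integrable G := by
    rw [← integrableOn_iff_integrable_of_support_subset (s := Set.Icc a b)]
    · exact hGc.integrableOn_compact isCompact_Icc
    · intro s hs
      by_contra hcon
      obtain ⟨e0, e1⟩ := hηout s hcon
      exact hs (by simp [G, e0, e1])
  have hGt : HasDerivAt (fun u => ∫ s in (0:ℝ)..u, G s) (G t) t := by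
    apply intervalIntegral.integral_hasDerivAt_right
    · exact hGi.intervalIntegrable
    · exact hGi.aestronglyMeasurable.stronglyMeasurableAtFilter
    · exact hGc.continuousAt (Icc_mem_nhds ht.1 ht.2)
  have e0 : η t = 1 := hη1 t (Metric.mem_closedBall_self hδ.le)
  have e1 : deriv η t = 0 := by
    have : η =ᶠ[nhds t] fun _ => (1:ℝ) := by
      filter_upwards [Metric.closedBall_mem_nhds t hδ] with u hu using hη1 u hu
    rw [this.deriv_eq]
    simp
  have e2 : G t = B t := by simp [G, e0, e1]
  rw [e2] at hGt
  refine hGt.congr_of_eventuallyEq ?_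
  filter_upwards [Metric.closedBall_mem_nhds t hδ, Icc_mem_nhds ht.1 ht.2] with s hs hs'
  have := hweak g hg hgs s (hJ hs')
  simp_rw [hGeq] at this
  rw [← this]
  have z0 : η 0 = 0 := hη0 0 (by
    rw [Real.dist_eq, zero_sub, abs_neg]
    exact le_trans (by linarith) (le_abs_self t))
  have : ∀ z, g (z, 0) = 0 := fun z => by simp [g, z0]
  simp only [this, integral_zero, sub_zero]
  apply integral_congr_ae
  filter_upwards [hS s hs'] with z hz
  simp only [g, F, hη1 s hs, h3 z (norm_lt_of_qf hz), one_mul]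

lemma qf_hasFDerivAt (z : Phase d) (u y : Euc d) :
    fderiv ℝ (qf (d := d)) z (u, y) = 2 * ⟪z.1, u⟫ + 2 * ⟪z.2, y⟫ := by
  have h1 : HasFDerivAt (fun z : Phase d => ‖z.1‖ ^ 2) _ z :=
    (hasFDerivAt_fst (𝕜 := ℝ) (p := z)).norm_sq
  have h2 : HasFDerivAt (fun z : Phase d => ‖z.2‖ ^ 2) _ z :=
    (hasFDerivAt_snd (𝕜 := ℝ) (p := z)).norm_sq
  have h3 : HasFDerivAt (qf (d := d)) _ z := h1.add h2
  rw [h3.fderiv]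
  simp

lemma qfpow_fderiv (n : ℕ) (z : Phase d) (u y : Euc d) :
    fderiv ℝ (fun z : Phase d => qf z ^ (n + 1)) z (u, y)
      = (n + 1) * qf z ^ n * (2 * ⟪z.1, u⟫ + 2 * ⟪z.2, y⟫) := by
  have h := ((qf_contDiff (d := d)).differentiable one_ne_zero z).hasFDerivAt.pow (n + 1)
  rw [h.fderiv, ← qf_hasFDerivAt]
  simp

lemma pow_mul_le {a b : ℝ} (ha : 0 ≤ a) (hb : 0 ≤ b) (n : ℕ) :
    a ^ n * b ≤ a ^ (n + 1) + b ^ (n + 1) := by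
  have h1 : 0 ≤ a ^ (n + 1) := by positivity
  have h2 : 0 ≤ b ^ (n + 1) := by positivity
  rcases le_total a b with h | h
  · have : a ^ n * b ≤ b ^ n * b := by gcongr
    rw [pow_succ b]; rw [pow_succ b] at h2
    linarith
  · have : a ^ n * b ≤ a ^ n * a := by gcongr
    rw [pow_succ a]; rw [pow_succ a] at h1
    linarith

lemma kk_bound {lw lx lv : ℝ} (hlw : 0 < lw) (hlx : 0 < lx) (hlv : 0 < lv) {φ : ℝ → ℝ} {φm φM : ℝ}
    (hφm : 0 < φm) (hφ : ∀ r, φm ≤ φ r ∧ φ r ≤ φM) (z w : Phase d) :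
    |2 * ⟪z.1, z.2⟫ + 2 * ⟪z.2, kk lw lx lv φ z w⟫|
      ≤ (1 + 5 * (lw + lx * φM + lv * φM)) * (qf z + qf w) := by
  have hM : 0 < φM := hφm.trans_le ((hφ 0).1.trans (hφ 0).2)
  set A := lw + lx * φM + lv * φM with hA
  have hA0 : 0 < A := by positivity
  have hp := hφ ‖z.1 - w.1‖
  set r := φ ‖z.1 - w.1‖ with hr
  have hr0 : 0 < r := hφm.trans_le hp.1
  have n1 : ‖w.1 - z.1‖ ≤ ‖w.1‖ + ‖z.1‖ := norm_sub_le _ _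
  have n2 : ‖w.2 - z.2‖ ≤ ‖w.2‖ + ‖z.2‖ := norm_sub_le _ _
  have a1 := norm_nonneg z.1
  have a2 := norm_nonneg z.2
  have a3 := norm_nonneg w.1
  have a4 := norm_nonneg w.2
  have hk : ‖kk lw lx lv φ z w‖ ≤ A * (‖w.1‖ + ‖z.1‖ + ‖w.2‖ + ‖z.2‖) := by
    have hx : lx * r ≤ lx * φM := by gcongr; exact hp.2
    have hv : lv * r ≤ lv * φM := by gcongr; exact hp.2
    have hx0 : 0 < lx * r := by positivity
    have hv0 : 0 < lv * r := by positivity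
    calc ‖kk lw lx lv φ z w‖ ≤ ‖lw • (w.1 - z.1)‖ + ‖(lx * r) • (w.1 - z.1)‖
            + ‖(lv * r) • (w.2 - z.2)‖ := norm_add₃_le
      _ = lw * ‖w.1 - z.1‖ + (lx * r) * ‖w.1 - z.1‖ + (lv * r) * ‖w.2 - z.2‖ := by
          rw [norm_smul, norm_smul, norm_smul, Real.norm_of_nonneg hlw.le,
            Real.norm_of_nonneg hx0.le, Real.norm_of_nonneg hv0.le]
      _ ≤ lw * (‖w.1‖ + ‖z.1‖) + (lx * φM) * (‖w.1‖ + ‖z.1‖) + (lv * φM) * (‖w.2‖ + ‖z.2‖) := by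
          gcongr
      _ ≤ A * (‖w.1‖ + ‖z.1‖ + ‖w.2‖ + ‖z.2‖) := by
          have : 0 ≤ (lv * φM) * (‖w.1‖ + ‖z.1‖) := by positivity
          have : 0 ≤ (lw + lx * φM) * (‖w.2‖ + ‖z.2‖) := by positivity
          rw [hA]; nlinarith
  have i1 : |⟪z.1, z.2⟫| ≤ ‖z.1‖ * ‖z.2‖ := abs_real_inner_le_norm _ _
  have i2 : |⟪z.2, kk lw lx lv φ z w⟫| ≤ ‖z.2‖ * (A * (‖w.1‖ + ‖z.1‖ + ‖w.2‖ + ‖z.2‖)) :=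
    (abs_real_inner_le_norm _ _).trans (by gcongr)
  have i3 : |2 * ⟪z.1, z.2⟫ + 2 * ⟪z.2, kk lw lx lv φ z w⟫|
      ≤ 2 * |⟪z.1, z.2⟫| + 2 * |⟪z.2, kk lw lx lv φ z w⟫| := by
    refine (abs_add_le _ _).trans ?_
    rw [abs_mul, abs_mul, abs_two]
  have i4 : 2 * (‖z.2‖ * (‖w.1‖ + ‖z.1‖ + ‖w.2‖ + ‖z.2‖)) ≤ 5 * (qf z + qf w) := by
    unfold qf
    nlinarith [sq_nonneg (‖z.2‖ - ‖w.1‖), sq_nonneg (‖z.2‖ - ‖z.1‖), sq_nonneg (‖z.2‖ - ‖w.2‖),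
      sq_nonneg ‖z.1‖, sq_nonneg ‖w.1‖, sq_nonneg ‖w.2‖]
  have i5 : 2 * (‖z.1‖ * ‖z.2‖) ≤ qf z + qf w := by
    unfold qf
    nlinarith [sq_nonneg (‖z.1‖ - ‖z.2‖), sq_nonneg ‖w.1‖, sq_nonneg ‖w.2‖]
  have i6 := mul_le_mul_of_nonneg_left i4 hA0.le
  nlinarith

lemma W_growth {lw lx lv : ℝ} (hlw : 0 < lw) (hlx : 0 < lx) (hlv : 0 < lv) {φ : ℝ → ℝ}
    (hφc : Continuous φ) {φm φM : ℝ}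
    (hφm : 0 < φm) (hφ : ∀ r, φm ≤ φ r ∧ φ r ≤ φM) {μ : ℝ → Measure (Phase d)}
    (hsol : IsMVSol lw lx lv φ (Set.Ici 0) μ)
    (hprob : ∀ t ∈ Set.Ici (0:ℝ), IsProbabilityMeasure (μ t))
    {a b N : ℝ} (ha : 0 ≤ a) (hS : ∀ s ∈ Set.Icc a b, SB (μ s) N) (n : ℕ)
    {s t : ℝ} (hs : s ∈ Set.Icc a b) (ht : t ∈ Set.Icc a b) :
    ∫ z, qf z ^ (n + 1) ∂(μ t) ≤
      Real.exp ((n + 1) * (3 * (1 + 5 * (lw + lx * φM + lv * φM))) * |t - s|)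
        * ∫ z, qf z ^ (n + 1) ∂(μ s) := by
  set c := 1 + 5 * (lw + lx * φM + lv * φM) with hc
  have hM : 0 < φM := hφm.trans_le ((hφ 0).1.trans (hφ 0).2)
  have hc0 : 0 < c := by positivity
  set κ : ℝ := (n + 1) * (3 * c) with hκ
  have hJ : Set.Icc a b ⊆ Set.Ici 0 := fun s hs => ha.trans hs.1
  have hf : ContDiff ℝ 1 (fun z : Phase d => qf z ^ (n + 1)) := qf_contDiff.pow _
  set W : ℝ → ℝ := fun s => ∫ z, qf z ^ (n + 1) ∂(μ s) with hW
  set B : ℝ → ℝ := fun s => ∫ z, ∫ w, fderiv ℝ (fun z : Phase d => qf z ^ (n + 1)) z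
    (z.2, kk lw lx lv φ z w) ∂(μ s) ∂(μ s) with hB
  have hWc : ContinuousOn W (Set.Icc a b) := cont_single hsol.2.1 hJ hS hf.continuous
  have hWd : ∀ u ∈ Set.Ioo a b, HasDerivAt W (B u) u := fun u hu =>
    weak_deriv hφc hsol hprob ha hS hf hu
  have hBb : ∀ u ∈ Set.Ioo a b, |B u| ≤ κ * W u := by
    intro u hu
    have hu' := Set.Ioo_subset_Icc_self hu
    have ip := hprob u (hJ hu')
    have hSu := hS u hu'
    have hi := hSu.integrable hf.continuous
    have e : B u = ∫ p, fderiv ℝ (fun z : Phase d => qf z ^ (n + 1)) p.1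
        (p.1.2, kk lw lx lv φ p.1 p.2) ∂((μ u).prod (μ u)) :=
      (integral_prod _ (hSu.integrable_prod hSu (H_cont hφc hf))).symm
    have hi2 : Integrable (fun p : Phase d × Phase d => (n + 1) * c * (2 * qf p.1 ^ (n+1) + qf p.2 ^ (n+1)))
        ((μ u).prod (μ u)) := by
      apply hSu.integrable_prod hSu
      have := qf_cont (d := d)
      fun_prop
    have e2 : ∫ p : Phase d × Phase d, (n + 1) * c * (2 * qf p.1 ^ (n+1) + qf p.2 ^ (n+1))
        ∂((μ u).prod (μ u)) = κ * W u := by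
      rw [integral_prod _ hi2]
      have : ∀ z : Phase d, ∫ w, (n + 1) * c * (2 * qf z ^ (n+1) + qf w ^ (n+1)) ∂(μ u)
          = (n + 1) * c * (2 * qf z ^ (n+1) + W u) := by
        intro z
        rw [integral_const_mul, integral_add (integrable_const _) hi]
        simp [hW]
      simp only [this]
      rw [integral_const_mul, integral_add (hi.const_mul 2) (integrable_const _),
        integral_const_mul]
      simp only [integral_const, probReal_univ, one_smul]
      rw [hκ]; simp only [hW]; ring
    rw [e, ← e2, ← Real.norm_eq_abs]
    refine (norm_integral_le_integral_norm _).trans ?_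
    refine integral_mono (hSu.integrable_prod hSu (H_cont hφc hf)).norm hi2 ?_
    intro p
    simp only
    rw [qfpow_fderiv, Real.norm_eq_abs, abs_mul]
    have q1 := qf_nonneg p.1
    have q2 := qf_nonneg p.2
    rw [abs_of_nonneg (by positivity)]
    have := kk_bound hlw hlx hlv hφm hφ p.1 p.2
    calc _ ≤ (n + 1) * qf p.1 ^ n * (c * (qf p.1 + qf p.2)) := by gcongr
      _ = (n + 1) * c * (qf p.1 ^ (n + 1) + qf p.1 ^ n * qf p.2) := by ring
      _ ≤ (n + 1) * c * (qf p.1 ^ (n + 1) + (qf p.1 ^ (n+1) + qf p.2 ^ (n+1))) := by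
          gcongr; exact pow_mul_le q1 q2 n
      _ = _ := by ring
  have hexp : ∀ k u : ℝ, HasDerivAt (fun u => Real.exp (k * u)) (Real.exp (k * u) * k) u := by
    intro k u
    have := ((hasDerivAt_id u).const_mul k).exp
    simpa using this
  have anti : AntitoneOn (fun u => Real.exp (-κ * u) * W u) (Set.Icc a b) := by
    apply antitoneOn_of_deriv_nonpos (convex_Icc a b)
    · exact (Continuous.continuousOn (by fun_prop)).mul hWc
    · intro u hu
      rw [interior_Icc] at hu
      exact ((hexp (-κ) u).mul (hWd u hu)).differentiableAt.differentiableWithinAt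
    · intro u hu
      rw [interior_Icc] at hu
      have := ((hexp (-κ) u).mul (hWd u hu)).deriv
      have h2 := (abs_le.1 (hBb u hu)).2
      have h3 := Real.exp_pos (-κ * u)
      erw [this]
      nlinarith
  have mono : MonotoneOn (fun u => Real.exp (κ * u) * W u) (Set.Icc a b) := by
    apply monotoneOn_of_deriv_nonneg (convex_Icc a b)
    · exact (Continuous.continuousOn (by fun_prop)).mul hWc
    · intro u hu
      rw [interior_Icc] at hu
      exact ((hexp κ u).mul (hWd u hu)).differentiableAt.differentiableWithinAt
    · intro u hu
      rw [interior_Icc] at hu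
      have := ((hexp κ u).mul (hWd u hu)).deriv
      have h2 := (abs_le.1 (hBb u hu)).1
      have h3 := Real.exp_pos (κ * u)
      erw [this]
      nlinarith
  have fin : ∀ k : ℝ, Real.exp (k * t) * W t ≤ Real.exp (k * s) * W s →
      W t ≤ Real.exp (k * s - k * t) * W s := by
    intro k h
    rw [Real.exp_sub, div_mul_eq_mul_div, le_div_iff₀ (Real.exp_pos _)]
    linarith
  rcases le_total s t with h | h
  · have := fin _ (anti hs ht h)
    rw [abs_of_nonneg (sub_nonneg.2 h)]
    convert this using 3
    ring
  · have := fin _ (mono ht hs h)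
    rw [abs_of_nonpos (sub_nonpos.2 h)]
    convert this using 3
    ring

lemma SB_growth {lw lx lv : ℝ} (hlw : 0 < lw) (hlx : 0 < lx) (hlv : 0 < lv) {φ : ℝ → ℝ}
    (hφc : Continuous φ) {φm φM : ℝ}
    (hφm : 0 < φm) (hφ : ∀ r, φm ≤ φ r ∧ φ r ≤ φM) {μ : ℝ → Measure (Phase d)}
    (hsol : IsMVSol lw lx lv φ (Set.Ici 0) μ)
    (hprob : ∀ t ∈ Set.Ici (0:ℝ), IsProbabilityMeasure (μ t))
    {a b N : ℝ} (ha : 0 ≤ a) (hS : ∀ s ∈ Set.Icc a b, SB (μ s) N)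
    {s t : ℝ} (hs : s ∈ Set.Icc a b) (ht : t ∈ Set.Icc a b) {R : ℝ} (hR0 : 0 ≤ R)
    (hR : SB (μ s) R) :
    SB (μ t) (Real.exp (3 * (1 + 5 * (lw + lx * φM + lv * φM)) * |t - s|) * R) := by
  set c := 3 * (1 + 5 * (lw + lx * φM + lv * φM)) with hc
  set R' := Real.exp (c * |t - s|) * R with hR'
  have hR'0 : 0 ≤ R' := by positivity
  have hJ : Set.Icc a b ⊆ Set.Ici 0 := fun s hs => ha.trans hs.1
  have ips := hprob s (hJ hs)
  have ipt := hprob t (hJ ht)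
  have hf : ∀ n, Continuous (fun z : Phase d => qf z ^ (n + 1)) := fun n => qf_cont.pow _
  have hWs : ∀ n : ℕ, ∫ z, qf z ^ (n + 1) ∂(μ s) ≤ R ^ (n + 1) := by
    intro n
    have : ∫ z, qf z ^ (n + 1) ∂(μ s) ≤ ∫ z, R ^ (n + 1) ∂(μ s) := by
      apply integral_mono_ae (hR.integrable (hf n)) (integrable_const _)
      filter_upwards [hR] with z hz
      exact pow_le_pow_left₀ (qf_nonneg z) hz _
    simpa using this
  have hWt : ∀ n : ℕ, ∫ z, qf z ^ (n + 1) ∂(μ t) ≤ R' ^ (n + 1) := by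
    intro n
    refine (W_growth hlw hlx hlv hφc hφm hφ hsol hprob ha hS n hs ht).trans ?_
    rw [hR', mul_pow, ← Real.exp_nat_mul]
    have e : ((n + 1 : ℕ) : ℝ) * (c * |t - s|) = (n + 1) * c * |t - s| := by push_cast; ring
    rw [e]
    gcongr
    exact hWs n
  have hk : ∀ k : ℕ, ∀ᵐ z ∂(μ t), qf z ≤ R' + 1 / ((k : ℝ) + 1) := by
    intro k
    set C := R' + 1 / ((k : ℝ) + 1) with hC
    have hCR : R' < C := by
      have : 0 < 1 / ((k : ℝ) + 1) := by positivity
      linarith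
    have hC0 : 0 < C := hR'0.trans_lt hCR
    have hm : ∀ n : ℕ, (μ t).real {z | C ≤ qf z} ≤ (R' / C) ^ (n + 1) := by
      intro n
      have h1 := mul_meas_ge_le_integral_of_nonneg (μ := μ t) (f := fun z : Phase d => qf z ^ (n+1))
        (Eventually.of_forall fun z => by have := qf_nonneg z; simp only [Pi.zero_apply]; positivity)
        ((hS t ht).integrable (hf n)) (C ^ (n + 1))
      have h2 : {z : Phase d | C ^ (n+1) ≤ qf z ^ (n+1)} = {z | C ≤ qf z} := by
        ext z
        simp only [Set.mem_ofPred_eq]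
        exact pow_le_pow_iff_left₀ hC0.le (qf_nonneg z) (Nat.succ_ne_zero n)
      rw [h2] at h1
      rw [div_pow, le_div_iff₀ (by positivity), mul_comm]
      exact h1.trans (hWt n)
    have hlim : Tendsto (fun n : ℕ => (R' / C) ^ (n + 1)) atTop (nhds 0) :=
      (tendsto_pow_atTop_nhds_zero_of_lt_one (by positivity)
        ((div_lt_one hC0).2 hCR)).comp (tendsto_add_atTop_nat 1)
    have h0 : (μ t).real {z | C ≤ qf z} = 0 :=
      le_antisymm (ge_of_tendsto' hlim hm) measureReal_nonneg
    rw [measureReal_eq_zero_iff] at h0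
    rw [ae_iff]
    refine measure_mono_null ?_ h0
    intro z hz
    exact (not_le.1 hz).le
  unfold SB
  filter_upwards [ae_all_iff.2 hk] with z hz
  have hl : Tendsto (fun k : ℕ => R' + 1 / ((k : ℝ) + 1)) atTop (nhds (R' + 0)) :=
    tendsto_const_nhds.add tendsto_one_div_add_atTop_nhds_zero_nat
  rw [add_zero] at hl
  exact ge_of_tendsto' hl hz

lemma SB.mono {ν : Measure (Phase d)} {N N' : ℝ} (h : SB ν N) (hN : N ≤ N') : SB ν N' := by
  unfold SB at *
  filter_upwards [h] with z hz using hz.trans hN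

lemma SB_exists {ν : Measure (Phase d)} (h : MeasureCompactSupport ν) :
    ∃ n : ℕ, SB ν n := by
  obtain ⟨K, hK, hν⟩ := h
  obtain ⟨C, hC⟩ := hK.bddAbove_image (qf_cont.continuousOn)
  obtain ⟨n, hn⟩ := exists_nat_ge C
  refine ⟨n, ?_⟩
  have : ∀ᵐ z ∂ν, z ∈ K := hν
  unfold SB
  filter_upwards [this] with z hz
  exact (hC (Set.mem_image_of_mem _ hz)).trans hn

def gm (N m : ℝ) (z : Phase d) : ℝ := max 0 (qf z - N) * max 0 (m - qf z)

lemma gm_cont (N m : ℝ) : Continuous (gm (d := d) N m) := by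
  have := qf_cont (d := d)
  unfold gm
  fun_prop

lemma gm_cs (N m : ℝ) : HasCompactSupport (gm (d := d) N m) := by
  refine HasCompactSupport.of_support_subset_isCompact (isCompact_K m) ?_
  intro z hz
  have h := right_ne_zero_of_mul hz
  by_contra hcon
  apply h
  have : m < qf z := not_le.1 hcon
  exact max_eq_left (by linarith)

lemma SB_iff {ν : Measure (Phase d)} [IsFiniteMeasure ν] {N : ℝ} :
    SB ν N ↔ ∀ m : ℕ, ∫ z, gm N m z ∂ν = 0 := by
  constructor
  · intro h m
    apply integral_eq_zero_of_ae
    filter_upwards [h] with z hz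
    simp [gm, max_eq_left (sub_nonpos.2 hz)]
  · intro h
    have h1 : ∀ m : ℕ, ∀ᵐ z ∂ν, gm N m z = 0 := by
      intro m
      have := (integral_eq_zero_iff_of_nonneg (μ := ν) (f := gm (d := d) N m) (fun z => by
        simp only [gm, Pi.zero_apply]; positivity)
        ((gm_cont N m).integrable_of_hasCompactSupport (gm_cs N m))).1 (h m)
      exact this
    unfold SB
    filter_upwards [ae_all_iff.2 h1] with z hz
    obtain ⟨m, hm⟩ := exists_nat_gt (qf z)
    have h2 := hz m
    by_contra hcon
    rw [not_le] at hcon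
    have : 0 < gm N m z := mul_pos (lt_max_of_lt_right (by linarith)) (lt_max_of_lt_right (by linarith))
    linarith

lemma SB_isClosed {μ : ℝ → Measure (Phase d)}
    (hvag : ∀ g : ZeroAtInftyContinuousMap (Phase d) ℝ,
      ContinuousOn (fun t => ∫ z, g z ∂(μ t)) (Set.Ici 0))
    (hprob : ∀ t ∈ Set.Ici (0:ℝ), IsProbabilityMeasure (μ t)) (N : ℝ) :
    IsClosed {t | t ∈ Set.Ici (0:ℝ) ∧ SB (μ t) N} := by
  have : {t | t ∈ Set.Ici (0:ℝ) ∧ SB (μ t) N} =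
      ⋂ m : ℕ, (Set.Ici (0:ℝ) ∩ (fun t => ∫ z, gm N m z ∂(μ t)) ⁻¹' {0}) := by
    ext t
    rw [Set.mem_iInter]
    constructor
    · rintro ⟨h1, h2⟩ m
      have := hprob t h1
      exact ⟨h1, SB_iff.1 h2 m⟩
    · intro h
      have := hprob t (h 0).1
      exact ⟨(h 0).1, SB_iff.2 fun m => (h m).2⟩
  rw [this]
  refine isClosed_iInter fun m => ?_
  refine ContinuousOn.preimage_isClosed_of_isClosed ?_ isClosed_Ici isClosed_singleton
  exact hvag ⟨⟨gm N m, gm_cont N m⟩, (gm_cs N m).is_zero_at_infty⟩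

def Good (μ : ℝ → Measure (Phase d)) (s : ℝ) : Prop :=
  ∃ ε > 0, ∃ N : ℝ, ∀ u ∈ Set.Ici (0:ℝ), |u - s| < ε → SB (μ u) N

lemma compact_bdd {μ : ℝ → Measure (Phase d)} {K : Set ℝ} (hK : IsCompact K)
    (hK0 : K ⊆ Set.Ici 0) (hg : ∀ s ∈ K, Good μ s) : ∃ N, ∀ s ∈ K, SB (μ s) N := by
  have : ∃ N, ∀ s ∈ K, 0 ≤ s → SB (μ s) N := by
    refine hK.induction_on (p := fun S => ∃ N, ∀ s ∈ S, 0 ≤ s → SB (μ s) N) ?_ ?_ ?_ ?_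
    · exact ⟨0, fun s hs => hs.elim⟩
    · rintro s t hst ⟨N, hN⟩
      exact ⟨N, fun u hu => hN u (hst hu)⟩
    · rintro s t ⟨N, hN⟩ ⟨N', hN'⟩
      refine ⟨max N N', fun u hu h0 => ?_⟩
      rcases hu with hu | hu
      · exact (hN u hu h0).mono (le_max_left _ _)
      · exact (hN' u hu h0).mono (le_max_right _ _)
    · intro s hs
      obtain ⟨ε, hε, N, hN⟩ := hg s hs
      refine ⟨Metric.ball s ε, mem_nhdsWithin_of_mem_nhds (Metric.ball_mem_nhds s hε), N, ?_⟩
      intro u hu h0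
      exact hN u h0 hu
  obtain ⟨N, hN⟩ := this
  exact ⟨N, fun s hs => hN s hs (hK0 hs)⟩

lemma uIcc_dist {a t s : ℝ} (hs : s ∈ Set.uIcc a t) : |s - t| ≤ |a - t| ∧ |s - a| ≤ |t - a| := by
  rcases le_total a t with h | h
  · rw [Set.uIcc_of_le h] at hs
    rw [abs_of_nonpos (sub_nonpos.2 hs.2), abs_of_nonpos (sub_nonpos.2 h),
      abs_of_nonneg (sub_nonneg.2 hs.1), abs_of_nonneg (sub_nonneg.2 h)]
    exact ⟨by linarith [hs.1], by linarith [hs.2]⟩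
  · rw [Set.uIcc_of_ge h] at hs
    rw [abs_of_nonneg (sub_nonneg.2 hs.1), abs_of_nonneg (sub_nonneg.2 h),
      abs_of_nonpos (sub_nonpos.2 hs.2), abs_of_nonpos (sub_nonpos.2 h)]
    exact ⟨by linarith [hs.2], by linarith [hs.1]⟩

lemma uIcc_dist_lt {a t s : ℝ} (hs : s ∈ Set.uIcc a t) (hsa : s ≠ a) : |s - t| < |a - t| := by
  refine lt_of_le_of_ne (uIcc_dist hs).1 fun h => hsa ?_
  rcases le_total a t with h' | h'
  · rw [Set.uIcc_of_le h'] at hs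
    rw [abs_of_nonpos (sub_nonpos.2 hs.2), abs_of_nonpos (sub_nonpos.2 h')] at h
    linarith
  · rw [Set.uIcc_of_ge h'] at hs
    rw [abs_of_nonneg (sub_nonneg.2 hs.1), abs_of_nonneg (sub_nonneg.2 h')] at h
    linarith

lemma uIcc_nonneg {a t : ℝ} (ha : 0 ≤ a) (ht : 0 ≤ t) : Set.uIcc a t ⊆ Set.Ici 0 :=
  fun _ hs => (le_min ha ht).trans hs.1

lemma bridge {lw lx lv : ℝ} (hlw : 0 < lw) (hlx : 0 < lx) (hlv : 0 < lv) {φ : ℝ → ℝ}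
    (hφc : Continuous φ) {φm φM : ℝ}
    (hφm : 0 < φm) (hφ : ∀ r, φm ≤ φ r ∧ φ r ≤ φM) {μ : ℝ → Measure (Phase d)}
    (hsol : IsMVSol lw lx lv φ (Set.Ici 0) μ)
    (hprob : ∀ t ∈ Set.Ici (0:ℝ), IsProbabilityMeasure (μ t))
    (hcpt : ∀ t ∈ Set.Ici (0:ℝ), MeasureCompactSupport (μ t))
    {a t : ℝ} (ha : 0 ≤ a) (ht : 0 ≤ t) (hat : a ≠ t)
    (hg : ∀ s ∈ Set.uIcc a t, s ≠ a → Good μ s) {R : ℝ} (hR0 : 0 ≤ R) (hR : SB (μ a) R) :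
    SB (μ t) (Real.exp (3 * (1 + 5 * (lw + lx * φM + lv * φM)) * |t - a|) * R) := by
  have hM : 0 < φM := hφm.trans_le ((hφ 0).1.trans (hφ 0).2)
  set c := 3 * (1 + 5 * (lw + lx * φM + lv * φM)) with hc
  have hc0 : 0 < c := by positivity
  obtain ⟨n, hn⟩ := SB_exists (hcpt t ht)
  set N := Real.exp (c * |a - t|) * n with hN
  have h1 : ∀ s ∈ Set.uIcc a t, s ≠ a → SB (μ s) N := by
    intro s hs hsa
    have hs0 : 0 ≤ s := uIcc_nonneg ha ht hs
    have hsub : Set.uIcc s t ⊆ Set.uIcc a t := Set.uIcc_subset_uIcc hs Set.right_mem_uIcc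
    have hna : a ∉ Set.uIcc s t := by
      intro h
      have h1 := uIcc_dist_lt hs hsa
      have h2 := (uIcc_dist h).1
      linarith
    obtain ⟨N', hN'⟩ := compact_bdd (μ := μ) (K := Set.uIcc s t) isCompact_uIcc
      (uIcc_nonneg hs0 ht) (fun u hu => hg u (hsub hu) (fun h => hna (h ▸ hu)))
    have := SB_growth hlw hlx hlv hφc hφm hφ hsol hprob (a := min s t) (b := max s t)
      (le_min hs0 ht) hN' (s := t) (t := s) Set.right_mem_uIcc Set.left_mem_uIcc
      (Nat.cast_nonneg n) hn
    refine this.mono ?_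
    rw [hN]
    have := (uIcc_dist hs).1
    gcongr
  have h2 : ∀ s ∈ Set.uIcc a t, SB (μ s) N := by
    intro s hs
    by_cases hsa : s = a
    · subst hsa
      have hcl := SB_isClosed hsol.2.1 hprob N
      have : s ∈ closure {t | t ∈ Set.Ici (0:ℝ) ∧ SB (μ t) N} := by
        rw [Metric.mem_closure_iff]
        intro ε hε
        set θ : ℝ := min 1 (ε / (2 * |t - s|)) with hθ
        have hts : 0 < |t - s| := abs_pos.2 (sub_ne_zero.2 hat.symm)
        have hθ0 : 0 < θ := lt_min one_pos (by positivity)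
        have hθ1 : θ ≤ 1 := min_le_left _ _
        have hθ2 : θ * |t - s| ≤ ε / 2 := by
          have : θ ≤ ε / (2 * |t - s|) := min_le_right _ _
          calc θ * |t - s| ≤ ε / (2 * |t - s|) * |t - s| := by gcongr
            _ = ε / 2 := by field_simp
        have hmem : s + θ * (t - s) ∈ Set.uIcc s t := by
          rcases le_total s t with h | h
          · rw [Set.uIcc_of_le h]
            constructor <;> nlinarith
          · rw [Set.uIcc_of_ge h]
            constructor <;> nlinarith
        refine ⟨s + θ * (t - s), ⟨uIcc_nonneg ha ht hmem, h1 _ hmem ?_⟩, ?_⟩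
        · intro h
          have : θ * (t - s) = 0 := by linarith
          rcases mul_eq_zero.1 this with h | h
          · linarith
          · exact hat (by linarith)
        · rw [Real.dist_eq]
          have : s - (s + θ * (t - s)) = -(θ * (t - s)) := by ring
          rw [this, abs_neg, abs_mul, abs_of_pos hθ0]
          linarith
      rw [hcl.closure_eq] at this
      exact this.2
    · exact h1 s hs hsa
  exact SB_growth hlw hlx hlv hφc hφm hφ hsol hprob (a := min a t) (b := max a t)
      (le_min ha ht) h2 (s := a) (t := t) Set.left_mem_uIcc Set.right_mem_uIcc hR0 hR

lemma all_good {lw lx lv : ℝ} (hlw : 0 < lw) (hlx : 0 < lx) (hlv : 0 < lv) {φ : ℝ → ℝ}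
    (hφc : Continuous φ) {φm φM : ℝ}
    (hφm : 0 < φm) (hφ : ∀ r, φm ≤ φ r ∧ φ r ≤ φM) {μ : ℝ → Measure (Phase d)}
    (hsol : IsMVSol lw lx lv φ (Set.Ici 0) μ)
    (hprob : ∀ t ∈ Set.Ici (0:ℝ), IsProbabilityMeasure (μ t))
    (hcpt : ∀ t ∈ Set.Ici (0:ℝ), MeasureCompactSupport (μ t)) (t : ℝ) (ht : 0 ≤ t) :
    Good μ t := by
  have hM : 0 < φM := hφm.trans_le ((hφ 0).1.trans (hφ 0).2)
  by_contra hbad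
  let F : Set ℝ := Set.Ici 0 ∩ {s | Good μ s}ᶜ
  have hFc : IsClosed F := by
    refine isClosed_Ici.inter (IsOpen.isClosed_compl ?_)
    rw [Metric.isOpen_iff]
    rintro s ⟨ε, hε, N, hN⟩
    refine ⟨ε / 2, by linarith, fun s' hs' => ⟨ε / 2, by linarith, N, fun u hu hus => ?_⟩⟩
    refine hN u hu ?_
    have h1 : |s' - s| < ε / 2 := hs'
    have := abs_sub_le u s' s
    linarith
  have : CompleteSpace F := hFc.completeSpace_coe
  have : Nonempty F := ⟨⟨t, ht, hbad⟩⟩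
  let f : ℕ → Set F := fun n => {x | SB (μ x) n}
  have hf : ∀ n, IsClosed (f n) := by
    intro n
    have h := (SB_isClosed hsol.2.1 hprob (n : ℝ)).preimage (continuous_subtype_val (p := (· ∈ F)))
    convert h using 1
    ext x
    exact ⟨fun h => ⟨x.2.1, h⟩, fun h => h.2⟩
  have hU : ⋃ n, f n = Set.univ := by
    rw [Set.eq_univ_iff_forall]
    intro x
    obtain ⟨n, hn⟩ := SB_exists (hcpt x x.2.1)
    exact Set.mem_iUnion.2 ⟨n, hn⟩
  obtain ⟨n, x0, hx0⟩ := nonempty_interior_of_iUnion_of_closed hf hU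
  rw [mem_interior_iff_mem_nhds, Metric.mem_nhds_iff] at hx0
  obtain ⟨ε, hε, hball⟩ := hx0
  have hn : ∀ y ∈ F, |y - x0| < ε → SB (μ y) n := fun y hy h => hball (a := ⟨y, hy⟩) h
  apply x0.2.2
  set c := 3 * (1 + 5 * (lw + lx * φM + lv * φM)) with hc
  have hc0 : 0 < c := by positivity
  refine ⟨ε, hε, Real.exp (c * ε) * n, fun u hu hux => ?_⟩
  have hn0 : (0:ℝ) ≤ n := Nat.cast_nonneg n
  have hx00 : (0:ℝ) ≤ x0 := x0.2.1
  by_cases huF : u ∈ F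
  · refine (hn u huF hux).mono ?_
    have : 1 ≤ Real.exp (c * ε) := Real.one_le_exp (by positivity)
    nlinarith
  · have hcomp : IsCompact (Set.uIcc (x0 : ℝ) u ∩ F) := isCompact_uIcc.inter_right hFc
    obtain ⟨a, ⟨ha1, ha2⟩, hmin⟩ := hcomp.exists_isMinOn ⟨x0, Set.left_mem_uIcc, x0.2⟩
      (f := fun s => |s - u|) (by fun_prop)
    have hau : a ≠ u := fun h => huF (h ▸ ha2)
    have hd := uIcc_dist ha1
    have hsub : Set.uIcc a u ⊆ Set.uIcc (x0 : ℝ) u := Set.uIcc_subset_uIcc ha1 Set.right_mem_uIcc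
    have hgood : ∀ s ∈ Set.uIcc a u, s ≠ a → Good μ s := by
      intro s hs hsa
      by_contra hcon
      have hsF : s ∈ F := ⟨uIcc_nonneg ha2.1 hu hs, hcon⟩
      have h1 : |a - u| ≤ |s - u| := hmin ⟨hsub hs, hsF⟩
      have h2 := uIcc_dist_lt hs hsa
      linarith
    have := bridge hlw hlx hlv hφc hφm hφ hsol hprob hcpt ha2.1 hu hau hgood hn0
      (hn a ha2 (lt_of_le_of_lt hd.2 hux))
    refine this.mono ?_
    have h3 : |u - a| ≤ ε := by
      rw [abs_sub_comm]
      rw [abs_sub_comm] at hux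
      linarith [hd.1]
    gcongr

lemma uniform_bdd {lw lx lv : ℝ} (hlw : 0 < lw) (hlx : 0 < lx) (hlv : 0 < lv) {φ : ℝ → ℝ}
    (hφc : Continuous φ) {φm φM : ℝ}
    (hφm : 0 < φm) (hφ : ∀ r, φm ≤ φ r ∧ φ r ≤ φM) {μ : ℝ → Measure (Phase d)}
    (hsol : IsMVSol lw lx lv φ (Set.Ici 0) μ)
    (hprob : ∀ t ∈ Set.Ici (0:ℝ), IsProbabilityMeasure (μ t))
    (hcpt : ∀ t ∈ Set.Ici (0:ℝ), MeasureCompactSupport (μ t)) (T : ℝ) :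
    ∃ N, ∀ s ∈ Set.Icc 0 T, SB (μ s) N :=
  compact_bdd isCompact_Icc (fun _ hs => hs.1)
    (fun s hs => all_good hlw hlx hlv hφc hφm hφ hsol hprob hcpt s hs.1)

set_option maxHeartbeats 1600000 in
lemma param_C1 {ν : Measure (Phase d)} [IsProbabilityMeasure ν] {N : ℝ} (hS : SB ν N)
    {F : Phase d → Phase d → ℝ} {F' : Phase d → Phase d → (Phase d →L[ℝ] ℝ)}
    (hF : Continuous fun p : Phase d × Phase d => F p.1 p.2)
    (hF' : Continuous fun p : Phase d × Phase d => F' p.1 p.2)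
    (hd : ∀ z w, HasFDerivAt (fun z => F z w) (F' z w) z) :
    ContDiff ℝ 1 (fun z => ∫ w, F z w ∂ν) ∧
      ∀ z u, fderiv ℝ (fun z => ∫ w, F z w ∂ν) z u = ∫ w, F' z w u ∂ν := by
  have hFz : ∀ z, Continuous (F z) := fun z => hF.comp (Continuous.prodMk_right z)
  have hFz' : ∀ z, Continuous (F' z) := fun z => hF'.comp (Continuous.prodMk_right z)
  have key : ∀ z, HasFDerivAt (fun z => ∫ w, F z w ∂ν) (∫ w, F' z w ∂ν) z := by
    intro z
    obtain ⟨C, hC⟩ := ((isCompact_closedBall z 1).prod (isCompact_K (d := d) N)).bddAbove_image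
      hF'.norm.continuousOn
    refine hasFDerivAt_integral_of_dominated_of_fderiv_le (s := Metric.closedBall z 1)
      (bound := fun _ => C) (F' := F')
      (Metric.closedBall_mem_nhds z one_pos) ?_ ?_ ?_ ?_ ?_ ?_
    · exact Eventually.of_forall fun x => (hFz x).aestronglyMeasurable
    · exact hS.integrable (hFz z)
    · exact (hFz' z).aestronglyMeasurable
    · filter_upwards [hS] with w hw x hx
      have hmem : (x, w) ∈ Metric.closedBall z 1 ×ˢ {z : Phase d | qf z ≤ N} := ⟨hx, hw⟩
      exact hC (Set.mem_image_of_mem (fun p : Phase d × Phase d => ‖F' p.1 p.2‖) hmem)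
    · exact integrable_const _
    · exact Eventually.of_forall fun w x _ => hd x w
  refine ⟨contDiff_one_iff_hasFDerivAt.2 ⟨fun z => ∫ w, F' z w ∂ν, ?_, key⟩, ?_⟩
  · have := continuous_parametric_integral_of_continuous (μ := ν) (f := F') hF' (isCompact_K (d := d) N)
    have hr : ν.restrict {z : Phase d | qf z ≤ N} = ν := Measure.restrict_eq_self_of_ae_mem hS
    rwa [hr] at this
  · intro z u
    rw [(key z).fderiv]
    have hi : Integrable (fun w => F' z w) ν :=
      SB.integrable (E := Phase d →L[ℝ] ℝ) (f := fun w => F' z w) hS (hFz' z)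
    exact ContinuousLinearMap.integral_apply hi u

lemma Phi_deriv {φ : ℝ → ℝ} (hφ : Continuous φ) (y : Euc d) :
    HasFDerivAt (fun y : Euc d => Phifun φ ‖y‖) (φ ‖y‖ • innerSL ℝ y) y := by
  have hc : Continuous fun s => φ (Real.sqrt s) := by fun_prop
  have hU : HasDerivAt (fun r => ∫ s in (0:ℝ)..r, φ (Real.sqrt s)) (φ (Real.sqrt (‖y‖ ^ 2)))
      (‖y‖ ^ 2) := intervalIntegral.integral_hasDerivAt_right (hc.intervalIntegrable _ _)
        hc.aestronglyMeasurable.stronglyMeasurableAtFilter hc.continuousAt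
  have hn : HasFDerivAt (fun y : Euc d => ‖y‖ ^ 2) (2 • innerSL ℝ y) y :=
    (hasStrictFDerivAt_norm_sq y).hasFDerivAt
  have h := (hU.comp_hasFDerivAt y hn).const_mul (1 / 2)
  rw [Real.sqrt_sq (norm_nonneg y)] at h
  refine HasFDerivAt.congr_fderiv h ?_
  ext u
  simp
  ring

lemma Phi_cont {φ : ℝ → ℝ} (hφ : Continuous φ) :
    Continuous (fun y : Euc d => Phifun φ ‖y‖) :=
  continuous_iff_continuousAt.2 fun y => (Phi_deriv hφ y).continuousAt

lemma Phi_nonneg {φ : ℝ → ℝ} (hφ : ∀ r, 0 ≤ φ r) (r : ℝ) : 0 ≤ Phifun φ r := by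
  unfold Phifun
  have := intervalIntegral.integral_nonneg (μ := volume) (sq_nonneg r) (fun s _ => hφ (Real.sqrt s))
  positivity

lemma PhiInt {φ : ℝ → ℝ} (hφ : Continuous φ) {ν : Measure (Phase d)} [IsProbabilityMeasure ν]
    {N : ℝ} (hS : SB ν N) :
    ContDiff ℝ 1 (fun z : Phase d => ∫ w, Phifun φ ‖z.1 - w.1‖ ∂ν) ∧
      ∀ (z u : Phase d), fderiv ℝ (fun z : Phase d => ∫ w, Phifun φ ‖z.1 - w.1‖ ∂ν) z u
        = ∫ w, φ ‖z.1 - w.1‖ * ⟪z.1 - w.1, u.1⟫ ∂ν := by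
  have h := param_C1 hS (F := fun z w => Phifun φ ‖z.1 - w.1‖)
    (F' := fun z w => (φ ‖z.1 - w.1‖ • innerSL ℝ (z.1 - w.1)).comp
      (ContinuousLinearMap.fst ℝ (Euc d) (Euc d))) ?_ ?_ ?_
  · refine ⟨h.1, fun z u => ?_⟩
    rw [h.2]
    rfl
  · exact (Phi_cont hφ).comp (by fun_prop : Continuous fun p : Phase d × Phase d => p.1.1 - p.2.1)
  · have h1 : Continuous fun p : Phase d × Phase d =>
        φ ‖p.1.1 - p.2.1‖ • innerSL ℝ (p.1.1 - p.2.1) := by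
      have h0 : Continuous fun p : Phase d × Phase d => φ ‖p.1.1 - p.2.1‖ := by fun_prop
      refine h0.smul ?_
      exact (innerSL ℝ (E := Euc d)).continuous.comp
        (by fun_prop : Continuous fun p : Phase d × Phase d => p.1.1 - p.2.1)
    exact h1.clm_comp continuous_const
  · intro z w
    have h1 : HasFDerivAt (fun z : Phase d => z.1 - w.1) (ContinuousLinearMap.fst ℝ (Euc d) (Euc d)) z :=
      hasFDerivAt_fst.sub_const _
    exact HasFDerivAt.comp z (Phi_deriv hφ (z.1 - w.1)) h1

lemma Mfun_deriv {lw lx lv : ℝ} {φ : ℝ → ℝ} (hφ : Continuous φ) {μ : ℝ → Measure (Phase d)}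
    (hsol : IsMVSol lw lx lv φ (Set.Ici 0) μ)
    (hprob : ∀ t ∈ Set.Ici (0:ℝ), IsProbabilityMeasure (μ t))
    {T N : ℝ} (hS : ∀ s ∈ Set.Icc 0 T, SB (μ s) N) {t : ℝ} (ht : t ∈ Set.Ioo 0 T) :
    HasDerivAt (Mfun φ μ)
      (2 * ∫ z, ∫ w, φ ‖z.1 - w.1‖ * ⟪z.1 - w.1, z.2⟫ ∂(μ t) ∂(μ t)) t := by
  have hJ : Set.Icc 0 T ⊆ Set.Ici 0 := fun s hs => hs.1
  let K : ℝ → ℝ → ℝ := fun s τ => ∫ z, ∫ w, φ ‖z.1 - w.1‖ * ⟪z.1 - w.1, z.2⟫ ∂(μ τ) ∂(μ s)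
  let F : ℝ → ℝ → ℝ := fun s τ => ∫ z, ∫ w, Phifun φ ‖z.1 - w.1‖ ∂(μ τ) ∂(μ s)
  have hPc : Continuous fun p : Phase d × Phase d => Phifun φ ‖p.1.1 - p.2.1‖ :=
    (Phi_cont hφ).comp (by fun_prop : Continuous fun p : Phase d × Phase d => p.1.1 - p.2.1)
  have hKc : ContinuousOn (fun p : ℝ × ℝ => K p.1 p.2) (Set.Icc 0 T ×ˢ Set.Icc 0 T) :=
    cont_prod hsol.2.1 hprob hJ hS (H := fun p => φ ‖p.1.1 - p.2.1‖ * ⟪p.1.1 - p.2.1, p.1.2⟫)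
      (by fun_prop)
  have hd1 : ∀ s ∈ Set.Ioo 0 T, ∀ τ ∈ Set.Icc 0 T, HasDerivAt (fun s => F s τ) (K s τ) s := by
    intro s hs τ hτ
    have i1 := hprob τ (hJ hτ)
    have i2 := hprob s (hJ (Set.Ioo_subset_Icc_self hs))
    have h := weak_deriv hφ hsol hprob le_rfl hS (PhiInt hφ (hS τ hτ)).1 hs
    simp only [(PhiInt hφ (hS τ hτ)).2] at h
    simpa using h
  have hsymm : ∀ s ∈ Set.Icc 0 T, ∀ τ ∈ Set.Icc 0 T, F s τ = F τ s := by
    intro s hs τ hτ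
    have i1 := hprob τ (hJ hτ)
    have i2 := hprob s (hJ hs)
    have hi : Integrable (Function.uncurry fun (z w : Phase d) => Phifun φ ‖z.1 - w.1‖)
        ((μ s).prod (μ τ)) := (hS s hs).integrable_prod (hS τ hτ) hPc
    refine (integral_integral_swap hi).trans ?_
    refine integral_congr_ae (Eventually.of_forall fun z => ?_)
    refine integral_congr_ae (Eventually.of_forall fun w => ?_)
    change Phifun φ ‖w.1 - z.1‖ = Phifun φ ‖z.1 - w.1‖
    rw [norm_sub_rev]
  have hd2 : ∀ s ∈ Set.Ioo 0 T, ∀ τ ∈ Set.Ioo 0 T, HasDerivAt (fun τ => F s τ) (K τ s) τ := by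
    intro s hs τ hτ
    refine (hd1 τ hτ s (Set.Ioo_subset_Icc_self hs)).congr_of_eventuallyEq ?_
    filter_upwards [Ioo_mem_nhds hτ.1 hτ.2] with u hu
    exact hsymm s (Set.Ioo_subset_Icc_self hs) u (Set.Ioo_subset_Icc_self hu)
  have hnb : Set.Ioo 0 T ×ˢ Set.Ioo 0 T ∈ nhds (t, t) :=
    prod_mem_nhds (Ioo_mem_nhds ht.1 ht.2) (Ioo_mem_nhds ht.1 ht.2)
  have hKat : ContinuousAt (fun p : ℝ × ℝ => K p.1 p.2) (t, t) :=
    hKc.continuousAt (prod_mem_nhds (Icc_mem_nhds ht.1 ht.2) (Icc_mem_nhds ht.1 ht.2))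
  have hKat2 : ContinuousAt (fun p : ℝ × ℝ => K p.2 p.1) (t, t) :=
    ContinuousAt.comp (f := Prod.swap) (g := fun p : ℝ × ℝ => K p.1 p.2) (x := (t, t)) hKat
      continuous_swap.continuousAt
  let S := ContinuousLinearMap.toSpanSingletonCLE (𝕜 := ℝ) (E := ℝ)
  have hs := hasStrictFDerivAt_uncurry_coprod (𝕜 := ℝ) (u := (t, t)) (f := F)
    (f₁ := fun s τ => S (K s τ)) (f₂ := fun s τ => S (K τ s)) ?_ ?_ ?_ ?_
  · have hdg : HasDerivAt (fun s : ℝ => (s, s)) ((1:ℝ), (1:ℝ)) t :=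
      (hasDerivAt_id t).prodMk (hasDerivAt_id t)
    have := HasFDerivAt.comp_hasDerivAt (f := fun s : ℝ => (s, s)) t hs.hasFDerivAt hdg
    refine HasDerivAt.congr_deriv (f := Mfun φ μ) this ?_
    change S (K t t) 1 + S (K t t) 1 = 2 * K t t
    simp [S]
    ring
  · filter_upwards [hnb] with p hp
    exact (hd1 p.1 hp.1 p.2 (Set.Ioo_subset_Icc_self hp.2)).hasFDerivAt
  · filter_upwards [hnb] with p hp
    exact (hd2 p.1 hp.1 p.2 hp.2).hasFDerivAt
  · exact S.continuous.continuousAt.comp hKat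
  · exact S.continuous.continuousAt.comp hKat2

lemma dbl_eq {ν : Measure (Phase d)} [IsProbabilityMeasure ν] {N : ℝ} (hS : SB ν N)
    {H : Phase d → Phase d → ℝ} (hH : Continuous fun p : Phase d × Phase d => H p.1 p.2) :
    ∫ z, ∫ w, H z w ∂ν ∂ν = ∫ p, H p.1 p.2 ∂(ν.prod ν) :=
  (integral_prod (fun p : Phase d × Phase d => H p.1 p.2) (hS.integrable_prod hS hH)).symm

lemma dbl_swap {ν : Measure (Phase d)} [IsProbabilityMeasure ν] (G : Phase d × Phase d → ℝ) :
    ∫ p, G p ∂(ν.prod ν) = ∫ p, G p.swap ∂(ν.prod ν) :=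
  (integral_prod_swap G).symm

lemma dbl_inner_zero {ν : Measure (Phase d)} [IsProbabilityMeasure ν] {N : ℝ} (hS : SB ν N)
    {g : Phase d → Euc d} (hg : Continuous g) (h0 : ∫ z, g z ∂ν = 0) :
    ∫ p, ⟪p.1.2, g p.2⟫ ∂(ν.prod ν) = 0 := by
  rw [← dbl_eq hS (H := fun z w => ⟪z.2, g w⟫) (by fun_prop)]
  have : ∀ z : Phase d, ∫ w, ⟪z.2, g w⟫ ∂ν = 0 := by
    intro z
    rw [integral_inner (hS.integrable hg), h0, inner_zero_right]
  simp [this]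

lemma claim1 {φ : ℝ → ℝ} (hφc : Continuous φ) {φm : ℝ} (hφ : ∀ r, φm ≤ φ r)
    {ν : Measure (Phase d)} [IsProbabilityMeasure ν] {N : ℝ} (hS : SB ν N)
    (h0 : ∫ z, z.2 ∂ν = 0) :
    2 * φm * ∫ z, ‖z.2‖ ^ 2 ∂ν ≤ ∫ z, ∫ w, φ ‖z.1 - w.1‖ * ‖z.2 - w.2‖ ^ 2 ∂ν ∂ν := by
  rw [dbl_eq hS (H := fun z w => φ ‖z.1 - w.1‖ * ‖z.2 - w.2‖ ^ 2) (by fun_prop)]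
  have hi : ∀ {G : Phase d × Phase d → ℝ}, Continuous G → Integrable G (ν.prod ν) :=
    fun hG => hS.integrable_prod hS hG
  have hle : ∫ p, φm * ‖p.1.2 - p.2.2‖ ^ 2 ∂(ν.prod ν)
      ≤ ∫ p, φ ‖p.1.1 - p.2.1‖ * ‖p.1.2 - p.2.2‖ ^ 2 ∂(ν.prod ν) := by
    refine integral_mono (hi (by fun_prop)) (hi (by fun_prop)) fun p => ?_
    exact mul_le_mul_of_nonneg_right (hφ _) (sq_nonneg _)
  refine le_trans (le_of_eq ?_) hle
  have e : (fun p : Phase d × Phase d => φm * ‖p.1.2 - p.2.2‖ ^ 2)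
      = fun p => φm * ‖p.1.2‖ ^ 2 + (φm * ‖p.2.2‖ ^ 2 + (-2 * φm) * ⟪p.1.2, p.2.2⟫) := by
    funext p
    rw [norm_sub_sq_real]
    ring
  rw [e, integral_add (hi (by fun_prop)) (hi (by fun_prop)),
    integral_add (hi (by fun_prop)) (hi (by fun_prop)), integral_const_mul, integral_const_mul,
    integral_const_mul, dbl_inner_zero hS (g := fun z => z.2) continuous_snd h0]
  have e1 : ∫ p : Phase d × Phase d, ‖p.1.2‖ ^ 2 ∂(ν.prod ν) = ∫ z, ‖z.2‖ ^ 2 ∂ν := by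
    rw [← dbl_eq hS (H := fun z _ => ‖z.2‖ ^ 2) (by fun_prop)]
    simp
  have e2 : ∫ p : Phase d × Phase d, ‖p.2.2‖ ^ 2 ∂(ν.prod ν) = ∫ z, ‖z.2‖ ^ 2 ∂ν := by
    rw [← dbl_eq hS (H := fun _ w => ‖w.2‖ ^ 2) (by fun_prop)]
    simp
  rw [e1, e2]
  ring

lemma energy_fderiv (lw : ℝ) (z : Phase d) :
    HasFDerivAt (fun z : Phase d => lw * ‖z.1‖ ^ 2 + ‖z.2‖ ^ 2)
      (lw • ((2 • innerSL ℝ z.1).comp (ContinuousLinearMap.fst ℝ (Euc d) (Euc d)))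
        + (2 • innerSL ℝ z.2).comp (ContinuousLinearMap.snd ℝ (Euc d) (Euc d))) z := by
  have h1 : HasFDerivAt (fun y : Euc d => ‖y‖ ^ 2) (2 • innerSL ℝ z.1) z.1 :=
    (hasStrictFDerivAt_norm_sq z.1).hasFDerivAt
  have h2 : HasFDerivAt (fun y : Euc d => ‖y‖ ^ 2) (2 • innerSL ℝ z.2) z.2 :=
    (hasStrictFDerivAt_norm_sq z.2).hasFDerivAt
  exact ((h1.comp z hasFDerivAt_fst).const_mul lw).add (h2.comp z hasFDerivAt_snd)

lemma E_identity {lw lx lv : ℝ} {φ : ℝ → ℝ} (hφc : Continuous φ)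
    {ν : Measure (Phase d)} [IsProbabilityMeasure ν] {N : ℝ} (hS : SB ν N)
    (h0 : ∫ z, z.1 ∂ν = 0) :
    (∫ z, ∫ w, (2 * lw * ⟪z.1, z.2⟫ + 2 * ⟪z.2, kk lw lx lv φ z w⟫) ∂ν ∂ν)
      + lx * (2 * ∫ z, ∫ w, φ ‖z.1 - w.1‖ * ⟪z.1 - w.1, z.2⟫ ∂ν ∂ν)
      = -(lv * ∫ z, ∫ w, φ ‖z.1 - w.1‖ * ‖z.2 - w.2‖ ^ 2 ∂ν ∂ν) := by
  have hkk := kk_cont (d := d) (lw := lw) (lx := lx) (lv := lv) hφc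
  have hi : ∀ {G : Phase d × Phase d → ℝ}, Continuous G → Integrable G (ν.prod ν) :=
    fun hG => hS.integrable_prod hS hG
  rw [dbl_eq hS (H := fun z w => φ ‖z.1 - w.1‖ * ‖z.2 - w.2‖ ^ 2) (by fun_prop),
    dbl_eq hS (H := fun z w => φ ‖z.1 - w.1‖ * ⟪z.1 - w.1, z.2⟫) (by fun_prop),
    dbl_eq hS (H := fun z w => 2 * lw * ⟪z.1, z.2⟫ + 2 * ⟪z.2, kk lw lx lv φ z w⟫)
      (by fun_prop)]
  have hA := dbl_inner_zero hS (g := fun z => z.1) continuous_fst h0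
  have hB : ∫ p, φ ‖p.1.1 - p.2.1‖ * ‖p.1.2 - p.2.2‖ ^ 2 ∂(ν.prod ν)
      = 2 * ∫ p, φ ‖p.1.1 - p.2.1‖ * ⟪p.1.2, p.1.2 - p.2.2⟫ ∂(ν.prod ν) := by
    have hsw := dbl_swap (ν := ν) fun p => φ ‖p.1.1 - p.2.1‖ * ⟪p.1.2, p.1.2 - p.2.2⟫
    rw [two_mul]
    nth_rewrite 2 [hsw]
    rw [← integral_add (hi (by fun_prop)) (hi (by simp only [Prod.fst_swap, Prod.snd_swap]; fun_prop))]
    congr 1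
    funext p
    simp only [Prod.fst_swap, Prod.snd_swap]
    rw [norm_sub_rev p.2.1 p.1.1, ← real_inner_self_eq_norm_sq, ← mul_add]
    simp only [inner_sub_left, inner_sub_right, real_inner_comm p.1.2 p.2.2]
    ring
  have hC : ∫ p : Phase d × Phase d,
        (2 * lw * ⟪p.1.1, p.1.2⟫ + 2 * ⟪p.1.2, kk lw lx lv φ p.1 p.2⟫) ∂(ν.prod ν)
      = 2 * lw * ∫ p : Phase d × Phase d, ⟪p.1.2, p.2.1⟫ ∂(ν.prod ν)
        + ((-(2 * lx)) * ∫ p, φ ‖p.1.1 - p.2.1‖ * ⟪p.1.1 - p.2.1, p.1.2⟫ ∂(ν.prod ν)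
        + (-(2 * lv)) * ∫ p, φ ‖p.1.1 - p.2.1‖ * ⟪p.1.2, p.1.2 - p.2.2⟫ ∂(ν.prod ν)) := by
    rw [← integral_const_mul, ← integral_const_mul, ← integral_const_mul,
      ← integral_add (hi (by fun_prop)) (hi (by fun_prop)),
      ← integral_add (hi (by fun_prop)) (hi (by fun_prop))]
    congr 1
    funext p
    simp only [kk, inner_add_right, inner_smul_right, inner_sub_right, inner_sub_left,
      real_inner_comm p.1.1 p.1.2, real_inner_comm p.2.1 p.1.2]
    ring
  rw [hC, hA, hB]
  ring

lemma E_deriv {lw lx lv : ℝ} {φ : ℝ → ℝ} (hφ : Continuous φ) {μ : ℝ → Measure (Phase d)}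
    (hsol : IsMVSol lw lx lv φ (Set.Ici 0) μ)
    (hprob : ∀ t ∈ Set.Ici (0:ℝ), IsProbabilityMeasure (μ t))
    (hcent : ∀ t ∈ Set.Ici (0:ℝ), (∫ z, z.1 ∂(μ t)) = 0 ∧ (∫ z, z.2 ∂(μ t)) = 0)
    {T N : ℝ} (hS : ∀ s ∈ Set.Icc 0 T, SB (μ s) N) {t : ℝ} (ht : t ∈ Set.Ioo 0 T) :
    HasDerivAt (fun s => (∫ z, (lw * ‖z.1‖ ^ 2 + ‖z.2‖ ^ 2) ∂μ s) + lx * Mfun φ μ s)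
      (-(lv * Vphi φ μ t)) t := by
  have i := hprob t ht.1.le
  have hSt := hS t (Set.Ioo_subset_Icc_self ht)
  have hc : ContDiff ℝ 1 (fun z : Phase d => lw * ‖z.1‖ ^ 2 + ‖z.2‖ ^ 2) :=
    (contDiff_const.mul (contDiff_fst.norm_sq ℝ)).add (contDiff_snd.norm_sq ℝ)
  have h1 := weak_deriv hφ hsol hprob le_rfl hS hc ht
  have h2 := (Mfun_deriv hφ hsol hprob hS ht).const_mul lx
  refine (h1.add h2).congr_deriv ?_
  unfold Vphi
  rw [← E_identity (lw := lw) (lx := lx) hφ hSt (hcent t ht.1.le).1]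
  congr 2
  funext z
  congr 1
  funext w
  rw [(energy_fderiv lw z).fderiv]
  simp
  ring

lemma lin_split {lw lx : ℝ} {φ : ℝ → ℝ} {μ : ℝ → Measure (Phase d)} {s N : ℝ}
    (hp : IsProbabilityMeasure (μ s)) (hS : SB (μ s) N) :
    (∫ z, (lw * ‖z.1‖ ^ 2 + ‖z.2‖ ^ 2) ∂μ s) + lx * Mfun φ μ s
      = lw * Xfun μ s + Vfun μ s + lx * Mfun φ μ s := by
  unfold Xfun Vfun
  rw [integral_add (hS.integrable (by fun_prop)) (hS.integrable (by fun_prop)), integral_const_mul]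

end Aux

/-- `V_φ ≥ 2 φ_m V`, and the resulting integral bound
`∫_0^t V ≤ (1/(2φ_m)) ∫_0^t V_φ = (E(0)-E(t))/(2φ_m λ_v) ≤ E(0)/(2φ_m λ_v)`. -/
theorem kinetic_herding_velocity_integral_bound
    {d : ℕ} (hd : 1 ≤ d) (lw lx lv : ℝ) (hlw : 0 < lw) (hlx : 0 < lx) (hlv : 0 < lv)
    (φ : ℝ → ℝ) (Kφ : NNReal) (hLip : LipschitzWith Kφ φ)
    (φm φM : ℝ) (hφm : 0 < φm) (hφ : ∀ r, φm ≤ φ r ∧ φ r ≤ φM)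
    (μ : ℝ → Measure (Phase d))
    (hsol : IsMVSol lw lx lv φ (Set.Ici 0) μ)
    (hprob : ∀ t ∈ Set.Ici (0:ℝ), IsProbabilityMeasure (μ t))
    (hcpt : ∀ t ∈ Set.Ici (0:ℝ), MeasureCompactSupport (μ t))
    (hcent : ∀ t ∈ Set.Ici (0:ℝ), (∫ z, z.1 ∂(μ t)) = 0 ∧ (∫ z, z.2 ∂(μ t)) = 0)
    (E : ℝ → ℝ) (hE : ∀ t, E t = lw * Xfun μ t + Vfun μ t + lx * Mfun φ μ t) :
    (∀ t ∈ Set.Ici (0:ℝ), 2 * φm * Vfun μ t ≤ Vphi φ μ t) ∧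
    (∀ t ∈ Set.Ici (0:ℝ),
      (∫ s in (0:ℝ)..t, Vfun μ s) ≤ (1 / (2 * φm)) * ∫ s in (0:ℝ)..t, Vphi φ μ s ∧
      (1 / (2 * φm)) * (∫ s in (0:ℝ)..t, Vphi φ μ s) = (E 0 - E t) / (2 * φm * lv) ∧
      (E 0 - E t) / (2 * φm * lv) ≤ E 0 / (2 * φm * lv)) := by
  have hφc := hLip.continuous
  have hφ0 : ∀ r, 0 ≤ φ r := fun r => hφm.le.trans (hφ r).1
  have h1 : ∀ t ∈ Set.Ici (0:ℝ), 2 * φm * Vfun μ t ≤ Vphi φ μ t := by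
    intro t ht
    have i := hprob t ht
    obtain ⟨n, hn⟩ := SB_exists (hcpt t ht)
    exact claim1 hφc (fun r => (hφ r).1) hn (hcent t ht).2
  refine ⟨h1, fun t ht => ?_⟩
  have ht0 : (0:ℝ) ≤ t := ht
  obtain ⟨N, hN⟩ := uniform_bdd hlw hlx hlv hφc hφm hφ hsol hprob hcpt t
  have hJ : Set.Icc 0 t ⊆ Set.Ici 0 := fun s hs => hs.1
  have hPc : Continuous fun p : Phase d × Phase d => Phifun φ ‖p.1.1 - p.2.1‖ :=
    (Phi_cont hφc).comp (by fun_prop : Continuous fun p : Phase d × Phase d => p.1.1 - p.2.1)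
  have cVphi : ContinuousOn (Vphi φ μ) (Set.Icc 0 t) :=
    cont_diag hsol.2.1 hprob hJ hN
      (H := fun p => φ ‖p.1.1 - p.2.1‖ * ‖p.1.2 - p.2.2‖ ^ 2) (by fun_prop)
  have cV : ContinuousOn (Vfun μ) (Set.Icc 0 t) :=
    cont_single hsol.2.1 hJ hN (f := fun z => ‖z.2‖ ^ 2) (by fun_prop)
  have cM : ContinuousOn (Mfun φ μ) (Set.Icc 0 t) :=
    cont_diag hsol.2.1 hprob hJ hN hPc
  have cL : ContinuousOn (fun s => ∫ z, (lw * ‖z.1‖ ^ 2 + ‖z.2‖ ^ 2) ∂μ s) (Set.Icc 0 t) :=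
    cont_single hsol.2.1 hJ hN (f := fun z => lw * ‖z.1‖ ^ 2 + ‖z.2‖ ^ 2) (by fun_prop)
  have iVphi : IntervalIntegrable (Vphi φ μ) volume 0 t :=
    ContinuousOn.intervalIntegrable (by rwa [Set.uIcc_of_le ht0])
  have iV : IntervalIntegrable (Vfun μ) volume 0 t :=
    ContinuousOn.intervalIntegrable (by rwa [Set.uIcc_of_le ht0])
  have hFTC := intervalIntegral.integral_eq_sub_of_hasDerivAt_of_le ht0
    (cL.add (continuousOn_const.mul cM))
    (fun s hs => E_deriv (lx := lx) (lv := lv) hφc hsol hprob hcent hN hs)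
    ((iVphi.const_mul lv).neg)
  have hEs : ∀ s ∈ Set.Icc 0 t, (∫ z, (lw * ‖z.1‖ ^ 2 + ‖z.2‖ ^ 2) ∂μ s) + lx * Mfun φ μ s
      = E s := by
    intro s hs
    rw [hE, lin_split (hprob s (hJ hs)) (hN s hs)]
  have hFTC' : -(lv * ∫ s in (0:ℝ)..t, Vphi φ μ s) = E t - E 0 := by
    rw [← hEs t ⟨ht0, le_rfl⟩, ← hEs 0 ⟨le_rfl, ht0⟩, ← intervalIntegral.integral_const_mul,
      ← intervalIntegral.integral_neg]
    exact hFTC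
  have hEt : 0 ≤ E t := by
    rw [hE]
    have a1 : 0 ≤ Xfun μ t := integral_nonneg fun z => sq_nonneg _
    have a2 : 0 ≤ Vfun μ t := integral_nonneg fun z => sq_nonneg _
    have a3 : 0 ≤ Mfun φ μ t :=
      integral_nonneg fun z => integral_nonneg fun w => Phi_nonneg hφ0 _
    positivity
  refine ⟨?_, ?_, ?_⟩
  · rw [← intervalIntegral.integral_const_mul]
    refine intervalIntegral.integral_mono_on ht0 iV (iVphi.const_mul _) fun s hs => ?_
    have := h1 s (hJ hs)
    rw [one_div, ← div_eq_inv_mul, le_div_iff₀ (by positivity)]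
    linarith
  · have : E 0 - E t = lv * ∫ s in (0:ℝ)..t, Vphi φ μ s := by linarith
    rw [this]
    field_simp
  · gcongr
    linarith
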